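/- arXiv:math/0406011 — 3 statements merged into one kernel-verified Lean document; each statement's English description precedes it below -/
import Mathlib

section
/- Let A : ℝ⁷ → ℝ⁷ be an invertible linear map satisfying A*φ₀ = φ₀. Then A is an orthogonal transformation of the standard inner product (⟨Au, Av⟩ = ⟨u, v⟩ for all u, v ∈ ℝ⁷) and det A = 1. In other words, the subgroup G₂ of GL(7,ℝ) preserving φ₀ also preserves the Euclidean metric g₀ and the orientation of ℝ⁷, so G₂ is a subgroup of SO(7). -/
open scoped RealInnerProductSpace

noncomputable section

/-- ℝ⁷ with its standard Euclidean inner product. -/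
abbrev E7 := EuclideanSpace ℝ (Fin 7)

/-- The coordinate 3-form dx_i ∧ dx_j ∧ dx_k on ℝ⁷ (indices 0,…,6 for x₁,…,x₇). -/
def tri7 (i j k : Fin 7) (u v w : E7) : ℝ :=
  Matrix.det !![u i, u j, u k; v i, v j, v k; w i, w j, w k]

/-- The G₂ 3-form φ₀ = dx₁₂₃ + dx₁₄₅ + dx₁₆₇ + dx₂₄₆ − dx₂₅₇ − dx₃₄₇ − dx₃₅₆. -/
def phi0 (u v w : E7) : ℝ :=
  tri7 0 1 2 u v w + tri7 0 3 4 u v w + tri7 0 5 6 u v w + tri7 1 3 5 u v w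
    - tri7 1 4 6 u v w - tri7 2 3 6 u v w - tri7 2 4 5 u v w


/-- Signed sum over all permutations of the letters `g`. -/
def g2P (n : ℕ) (g : Fin n → Fin 7) (F : (Fin n → Fin 7) → ℤ) : ℤ :=
  ∑ σ : Equiv.Perm (Fin n), (Equiv.Perm.sign σ : ℤ) * F (fun i => g (σ i))

def g2sg {n : ℕ} (p : Fin (n+1)) : ℤ := if p = 0 then 1 else -1

def g2rem {n : ℕ} (g : Fin (n+1) → Fin 7) (p : Fin (n+1)) : Fin n → Fin 7 :=
  fun i => if i.succ = p then g 0 else g i.succ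

theorem g2P_succ (n : ℕ) (g : Fin (n+1) → Fin 7) (F : (Fin (n+1) → Fin 7) → ℤ) :
    g2P (n+1) g F = ∑ p : Fin (n+1), g2sg p *
      g2P n (g2rem g p) (fun h => F (Fin.cons (g p) h)) := by
  unfold g2P
  rw [← Equiv.Perm.decomposeFin.symm.sum_comp, Fintype.sum_prod_type]
  refine Finset.sum_congr rfl fun p _ => ?_
  rw [Finset.mul_sum]
  refine Finset.sum_congr rfl fun e _ => ?_
  rw [Equiv.Perm.decomposeFin.symm_sign, ← mul_assoc]
  congr 1
  · unfold g2sg; split_ifs <;> simp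
  · congr 1
    funext i
    refine Fin.cases ?_ (fun j => ?_) i
    · simp
    · simp only [Equiv.Perm.decomposeFin_symm_apply_succ, Fin.cons_succ, g2rem, Equiv.swap_apply_def]
      simp only [Fin.succ_ne_zero, if_false]
      split_ifs <;> rfl

theorem g2P_mul (n : ℕ) (g : Fin n → Fin 7) (k : ℤ) (F : (Fin n → Fin 7) → ℤ) :
    g2P n g (fun h => k * F h) = k * g2P n g F := by
  unfold g2P
  rw [Finset.mul_sum]
  exact Finset.sum_congr rfl fun e _ => by ring

/-- Structure constants. -/
def g2d (i j k p q r : Fin 7) : ℤ :=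
  if p = i then (if q = j then (if r = k then 1 else 0) else if q = k then (if r = j then -1 else 0) else 0)
  else if p = j then (if q = k then (if r = i then 1 else 0) else if q = i then (if r = k then -1 else 0) else 0)
  else if p = k then (if q = i then (if r = j then 1 else 0) else if q = j then (if r = i then -1 else 0) else 0)
  else 0

def g2c (p q r : Fin 7) : ℤ :=
  g2d 0 1 2 p q r + g2d 0 3 4 p q r + g2d 0 5 6 p q r + g2d 1 3 5 p q r
    - g2d 1 4 6 p q r - g2d 2 3 6 p q r - g2d 2 4 5 p q r

def g2prune (a : ℤ) (b : ℤ) : ℤ := if a = 0 then 0 else a * b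

theorem g2prune_eq (a b : ℤ) : g2prune a b = a * b := by
  unfold g2prune; split_ifs with h <;> simp [h]

theorem g2P_two (n : ℕ) (g : Fin (n+2) → Fin 7) (k : Fin 7 → Fin 7 → ℤ)
    (F : (Fin n → Fin 7) → ℤ) :
    g2P (n+2) g (fun h => k (h 0) (h 1) * F (fun i => h i.succ.succ)) =
    ∑ a : Fin (n+2), ∑ b : Fin (n+1),
      g2prune (g2sg a * g2sg b * k (g a) (g2rem g a b)) (g2P n (g2rem (g2rem g a) b) F) := by
  rw [g2P_succ]
  refine Finset.sum_congr rfl fun a _ => ?_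
  rw [g2P_succ, Finset.mul_sum]
  refine Finset.sum_congr rfl fun b _ => ?_
  rw [g2prune_eq]
  have : ∀ h : Fin n → Fin 7, k ((Fin.cons (g a) (Fin.cons (g2rem g a b) h : Fin (n+1) → Fin 7) : Fin (n+2) → Fin 7) 0)
     ((Fin.cons (g a) (Fin.cons (g2rem g a b) h : Fin (n+1) → Fin 7) : Fin (n+2) → Fin 7) 1) = k (g a) (g2rem g a b) := by
    intro h; rfl
  simp only [this, Fin.cons_succ]
  rw [g2P_mul]
  ring

theorem g2P_three (g : Fin 3 → Fin 7) (k : Fin 7 → Fin 7 → Fin 7 → ℤ) :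
    g2P 3 g (fun h => k (h 0) (h 1) (h 2)) =
      k (g 0) (g 1) (g 2) - k (g 0) (g 2) (g 1) - k (g 1) (g 0) (g 2)
      + k (g 1) (g 2) (g 0) + k (g 2) (g 0) (g 1) - k (g 2) (g 1) (g 0) := by
  have h1 : ∀ (g : Fin 0 → Fin 7) (F : (Fin 0 → Fin 7) → ℤ), g2P 0 g F = F g := by
    intro g F
    simp only [g2P, Finset.univ_unique, Finset.sum_singleton]
    rw [show (default : Equiv.Perm (Fin 0)) = 1 from Subsingleton.elim _ _]
    simp
  simp only [g2P_succ, h1, Fin.sum_univ_succ, Fin.sum_univ_zero]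
  change 1 * (1 * (1 * k (g 0) (g 1) (g 2) + 0) + ((-1) * (1 * k (g 0) (g 2) (g 1) + 0) + 0))
    + ((-1) * (1 * (1 * k (g 1) (g 0) (g 2) + 0) + ((-1) * (1 * k (g 1) (g 2) (g 0) + 0) + 0))
    + ((-1) * (1 * (1 * k (g 2) (g 1) (g 0) + 0) + ((-1) * (1 * k (g 2) (g 0) (g 1) + 0) + 0))
    + 0)) = _
  ring

def g2six (g : Fin 3 → Fin 7) : ℤ := 6 * g2c (g 0) (g 1) (g 2)

theorem g2c_anti : ∀ a b c, g2c a b c = - g2c a c b ∧ g2c a b c = - g2c b a c := by decide +kernel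

theorem g2six_eq (g : Fin 3 → Fin 7) :
    g2P 3 g (fun h => g2c (h 0) (h 1) (h 2)) = g2six g := by
  rw [g2P_three, g2six]
  have h1 := fun a b c => (g2c_anti a b c).1
  have h2 := fun a b c => (g2c_anti a b c).2
  linarith [h1 (g 0) (g 1) (g 2), h1 (g 1) (g 0) (g 2), h1 (g 2) (g 0) (g 1), h2 (g 0) (g 1) (g 2),
    h2 (g 0) (g 2) (g 1), h2 (g 1) (g 2) (g 0)]

/-- Table of the structure constants (shifted by one), in base four. -/
def g2N4 : ℕ :=
  107017737686688832186905924265557916846565999640999659976277428336477110188375225429138854406297771884918359270384575958273695805244576610575775844077607584927335891395507980838342701044684456587571995694421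

def g2t (a b c : Fin 7) : ℤ := Int.subNatNat (g2N4 / 4 ^ (49 * a.val + 7 * b.val + c.val) % 4) 1

theorem g2t_eq : ∀ a b c, g2t a b c = g2c a b c := by decide +kernel

def g2tt (g : Fin 3 → Fin 7) : ℤ := g2t (g 0) (g 1) (g 2)

def g2W (p q : Fin 7) : ℤ :=
  ∑ a : Fin 7, ∑ b : Fin 6,
    g2prune (g2sg a * g2sg b * g2t p a (g2rem id a b)) (∑ a' : Fin 5, ∑ b' : Fin 4,
      g2prune (g2sg a' * g2sg b' * g2t q (g2rem (g2rem id a) b a') (g2rem (g2rem (g2rem id a) b) a' b'))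
       (6 * g2tt (g2rem (g2rem (g2rem (g2rem id a) b) a') b')))

theorem g2W_eq : ∀ p q, g2W p q = if p = q then 144 else 0 := by decide +kernel

theorem g2P_eval (p q : Fin 7) :
    g2P 7 id (fun h => g2c p (h 0) (h 1) * (g2c q (h 2) (h 3) * g2c (h 4) (h 5) (h 6)))
      = if p = q then 144 else 0 := by
  rw [← g2W_eq]
  refine (g2P_two 5 id (g2c p) (fun h => g2c q (h 0) (h 1) * g2c (h 2) (h 3) (h 4))).trans ?_
  simp only [g2W, g2tt, g2t_eq]
  refine Finset.sum_congr rfl fun a _ => Finset.sum_congr rfl fun b _ => ?_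
  congr 1
  refine (g2P_two 3 _ (g2c q) (fun h => g2c (h 0) (h 1) (h 2))).trans ?_
  refine Finset.sum_congr rfl fun a' _ => Finset.sum_congr rfl fun b' _ => ?_
  rw [g2six_eq, g2six]

theorem g2phi_add (u v w x : E7) : phi0 u v (w + x) = phi0 u v w + phi0 u v x := by
  simp only [phi0, tri7, Matrix.det_fin_three, Matrix.of_apply, Matrix.cons_val, PiLp.add_apply]
  ring

theorem g2phi_smul (u v w : E7) (c : ℝ) : phi0 u v (c • w) = c * phi0 u v w := by
  simp only [phi0, tri7, Matrix.det_fin_three, Matrix.of_apply, Matrix.cons_val, PiLp.smul_apply,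
    smul_eq_mul]
  ring

theorem g2phi_cyc (u v w : E7) : phi0 u v w = phi0 v w u := by
  simp only [phi0, tri7, Matrix.det_fin_three, Matrix.of_apply, Matrix.cons_val]
  ring

theorem g2phi_add1 (u v w x : E7) : phi0 (w + x) u v = phi0 w u v + phi0 x u v := by
  rw [g2phi_cyc, g2phi_add, g2phi_cyc w, g2phi_cyc x]

theorem g2phi_add2 (u v w x : E7) : phi0 u (w + x) v = phi0 u w v + phi0 u x v := by
  rw [g2phi_cyc, g2phi_add1, g2phi_cyc u w, g2phi_cyc u x]

theorem g2phi_smul1 (u v w : E7) (c : ℝ) : phi0 (c • w) u v = c * phi0 w u v := by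
  rw [g2phi_cyc, g2phi_smul, g2phi_cyc w]

theorem g2phi_smul2 (u v w : E7) (c : ℝ) : phi0 u (c • w) v = c * phi0 u w v := by
  rw [g2phi_cyc, g2phi_smul1, g2phi_cyc u w]

/-- The multilinear map whose alternatization is the seven-form. -/
def g2N (u v : E7) : MultilinearMap ℝ (fun _ : Fin 7 => E7) ℝ where
  toFun w := phi0 u (w 0) (w 1) * (phi0 v (w 2) (w 3) * phi0 (w 4) (w 5) (w 6))
  map_update_add' := by
    intro inst m i x y
    obtain rfl : inst = instDecidableEqFin 7 := Subsingleton.elim _ _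
    fin_cases i <;> simp [g2phi_add, g2phi_add1, g2phi_add2] <;> ring
  map_update_smul' := by
    intro inst m i c x
    obtain rfl : inst = instDecidableEqFin 7 := Subsingleton.elim _ _
    fin_cases i <;> simp [g2phi_smul, g2phi_smul1, g2phi_smul2] <;> ring

abbrev g2e (a : Fin 7) : E7 := EuclideanSpace.basisFun (Fin 7) ℝ a

theorem g2phi_basis (u : E7) (a b : Fin 7) :
    phi0 u (g2e a) (g2e b) = ∑ p, u p * (g2c p a b : ℝ) := by
  fin_cases a <;> fin_cases b <;>
  simp [phi0, tri7, Matrix.det_fin_three, g2e, g2c, g2d, Fin.sum_univ_succ]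

theorem g2phi_basis3 (a b c : Fin 7) :
    phi0 (g2e a) (g2e b) (g2e c) = (g2c a b c : ℝ) := by
  rw [g2phi_basis]
  simp [g2e]

theorem g2N_basis (u v : E7) (s : Fin 7 → Fin 7) :
    g2N u v (fun i => g2e (s i)) = ∑ p, ∑ q, u p * v q *
      ((g2c p (s 0) (s 1) * (g2c q (s 2) (s 3) * g2c (s 4) (s 5) (s 6)) : ℤ) : ℝ) := by
  change phi0 u _ _ * (phi0 v _ _ * phi0 _ _ _) = _
  rw [g2phi_basis, g2phi_basis, g2phi_basis3, ← mul_assoc, Finset.sum_mul_sum, Finset.sum_mul]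
  refine Finset.sum_congr rfl fun p _ => ?_
  rw [Finset.sum_mul]
  refine Finset.sum_congr rfl fun q _ => ?_
  push_cast
  ring


def g2Om (u v : E7) : E7 [⋀^Fin 7]→ₗ[ℝ] ℝ := MultilinearMap.alternatization (g2N u v)

theorem g2Om_basis (u v : E7) : g2Om u v g2e = 144 * ⟪u, v⟫ := by
  rw [g2Om, MultilinearMap.alternatization_apply]
  have h : ∀ σ : Equiv.Perm (Fin 7), Equiv.Perm.sign σ • (g2N u v).domDomCongr σ g2e =
      ∑ p, ∑ q, u p * v q * (((Equiv.Perm.sign σ : ℤ) * (g2c p (σ 0) (σ 1) *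
        (g2c q (σ 2) (σ 3) * g2c (σ 4) (σ 5) (σ 6))) : ℤ) : ℝ) := by
    intro σ
    rw [MultilinearMap.domDomCongr_apply, g2N_basis u v (fun i => σ i), Units.smul_def,
      zsmul_eq_mul, Finset.mul_sum]
    refine Finset.sum_congr rfl fun p _ => ?_
    rw [Finset.mul_sum]
    refine Finset.sum_congr rfl fun q _ => ?_
    push_cast
    ring
  rw [Finset.sum_congr rfl fun σ _ => h σ, Finset.sum_comm]
  have h2 : ∀ p q : Fin 7, ∑ σ : Equiv.Perm (Fin 7), u p * v q * (((Equiv.Perm.sign σ : ℤ) *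
      (g2c p (σ 0) (σ 1) * (g2c q (σ 2) (σ 3) * g2c (σ 4) (σ 5) (σ 6))) : ℤ) : ℝ)
      = u p * v q * (if p = q then 144 else 0) := by
    intro p q
    rw [← Finset.mul_sum, ← Int.cast_sum]
    have := g2P_eval p q
    simp only [g2P, id] at this
    rw [this]
    split_ifs <;> simp
  have h3 : ∀ p : Fin 7, ∑ σ : Equiv.Perm (Fin 7), ∑ q, u p * v q *
      (((Equiv.Perm.sign σ : ℤ) *
      (g2c p (σ 0) (σ 1) * (g2c q (σ 2) (σ 3) * g2c (σ 4) (σ 5) (σ 6))) : ℤ) : ℝ)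
      = 144 * (u p * v p) := by
    intro p
    rw [Finset.sum_comm, Finset.sum_congr rfl fun q _ => h2 p q]
    simp
    ring
  rw [Finset.sum_congr rfl fun p _ => h3 p, ← Finset.mul_sum, PiLp.inner_apply]
  congr 1
  refine Finset.sum_congr rfl fun p _ => ?_
  simp [mul_comm]

theorem g2Om_det (u v : E7) (A : E7 →ₗ[ℝ] E7) :
    g2Om u v (A ∘ g2e) = LinearMap.det A * g2Om u v g2e := by
  have hb : g2e = ⇑(EuclideanSpace.basisFun (Fin 7) ℝ).toBasis := by
    simp
  rw [AlternatingMap.eq_smul_basis_det (EuclideanSpace.basisFun (Fin 7) ℝ).toBasis (g2Om u v)]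
  rw [AlternatingMap.smul_apply, AlternatingMap.smul_apply, Module.Basis.det_comp, hb,
    Module.Basis.det_self]
  simp only [smul_eq_mul]
  ring

theorem g2Om_inv (u v : E7) (A : E7 →ₗ[ℝ] E7)
    (hphi : ∀ u v w : E7, phi0 (A u) (A v) (A w) = phi0 u v w) :
    g2Om (A u) (A v) (A ∘ g2e) = g2Om u v g2e := by
  rw [g2Om, g2Om, MultilinearMap.alternatization_apply, MultilinearMap.alternatization_apply]
  refine Finset.sum_congr rfl fun σ _ => ?_
  congr 1
  simp only [MultilinearMap.domDomCongr_apply]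
  change phi0 (A u) (A _) (A _) * (phi0 (A v) (A _) (A _) * phi0 (A _) (A _) (A _)) =
    phi0 u _ _ * (phi0 v _ _ * phi0 _ _ _)
  simp only [hphi]

theorem g2_key (u v : E7) (A : E7 →ₗ[ℝ] E7)
    (hphi : ∀ u v w : E7, phi0 (A u) (A v) (A w) = phi0 u v w) :
    LinearMap.det A * ⟪A u, A v⟫ = ⟪u, v⟫ := by
  have h1 := g2Om_inv u v A hphi
  rw [g2Om_det, g2Om_basis, g2Om_basis] at h1
  linarith

theorem g2_det (A : E7 →ₗ[ℝ] E7)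
    (hphi : ∀ u v w : E7, phi0 (A u) (A v) (A w) = phi0 u v w) :
    LinearMap.det A = 1 := by
  have h : LinearMap.det A • (LinearMap.adjoint A ∘ₗ A) = LinearMap.id := by
    ext1 u
    refine ext_inner_right ℝ fun v => ?_
    simp only [LinearMap.smul_apply, LinearMap.comp_apply, LinearMap.id_apply]
    rw [real_inner_smul_left, LinearMap.adjoint_inner_left]
    exact g2_key u v A hphi
  have h2 := congrArg LinearMap.det h
  have h3 : LinearMap.det (LinearMap.adjoint A) = LinearMap.det A := by
    let b := EuclideanSpace.basisFun (Fin 7) ℝ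
    rw [← LinearMap.det_toMatrix b.toBasis, ← LinearMap.det_toMatrix b.toBasis A,
      LinearMap.toMatrix_adjoint, Matrix.det_conjTranspose]
    simp
  rw [LinearMap.det_smul, LinearMap.det_comp, h3, LinearMap.det_id, finrank_euclideanSpace_fin]
    at h2
  have h9 : LinearMap.det A ^ 9 = 1 ^ 9 := by rw [one_pow, ← h2]; ring
  exact (Odd.strictMono_pow (by decide : Odd 9)).injective h9

/-- If an invertible linear map A : ℝ⁷ → ℝ⁷ preserves the 3-form φ₀ (A*φ₀ = φ₀), then A
preserves the standard inner product and has determinant 1; i.e. G₂ ⊆ SO(7). -/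
theorem g2_preserves_metric_and_orientation (A : E7 →ₗ[ℝ] E7)
    (hA : Function.Bijective A)
    (hphi : ∀ u v w : E7, phi0 (A u) (A v) (A w) = phi0 u v w) :
    (∀ u v : E7, ⟪A u, A v⟫ = ⟪u, v⟫) ∧ LinearMap.det A = 1 := by
  have hd := g2_det A hphi
  refine ⟨fun u v => ?_, hd⟩
  have h := g2_key u v A hphi
  rwa [hd, one_mul] at h
end
end

section
/- The group G₂ = { A : ℝ⁷ → ℝ⁷ invertible linear : A*φ₀ = φ₀ } is a compact subset of the space of continuous linear endomorphisms of ℝ⁷ (equivalently, the corresponding set of 7×7 real matrices is compact). -/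
open scoped RealInnerProductSpace

noncomputable section

/-- The skew matrix of the 2-form obtained by contracting the 3-form with `u`. -/
def crossMat (u : Fin 7 → ℝ) : Matrix (Fin 7) (Fin 7) ℝ :=
  !![0, u 2, -u 1, u 4, -u 3, u 6, -u 5;
     -u 2, 0, u 0, u 5, -u 6, -u 3, u 4;
     u 1, -u 0, 0, -u 6, -u 5, u 4, u 3;
     -u 4, -u 5, u 6, 0, u 0, u 1, -u 2;
     u 3, u 6, u 5, -u 0, 0, -u 2, -u 1;
     -u 6, u 3, -u 4, -u 1, u 2, 0, u 0;
     u 5, -u 4, -u 3, u 2, u 1, -u 0, 0]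

open Matrix

lemma phi0_eq (u v w : E7) :
    phi0 u v w = v.ofLp ⬝ᵥ (crossMat u.ofLp *ᵥ w.ofLp) := by
  simp [phi0, tri7, crossMat, Matrix.det_fin_three, dotProduct, mulVec, Fin.sum_univ_seven]
  ring

lemma crossMat_transpose (u : Fin 7 → ℝ) : (crossMat u)ᵀ = - crossMat u := by
  ext i j
  fin_cases i <;> fin_cases j <;> simp [crossMat]

lemma crossMat_mulVec_self (u : Fin 7 → ℝ) : crossMat u *ᵥ u = 0 := by
  ext i
  fin_cases i <;> simp [crossMat, mulVec, dotProduct, Fin.sum_univ_seven] <;> ring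

lemma crossMat_sq (u : Fin 7 → ℝ) :
    crossMat u * crossMat u = -((u ⬝ᵥ u) • (1 : Matrix (Fin 7) (Fin 7) ℝ)) + vecMulVec u u := by
  ext i j
  fin_cases i <;> fin_cases j <;>
    simp [crossMat, Matrix.mul_apply, vecMulVec_apply, dotProduct, Fin.sum_univ_seven] <;> ring

lemma det_rank_two (a : ℝ) (ha : a ≠ 0) (x y z w : Fin 7 → ℝ) :
    (a • (1 : Matrix (Fin 7) (Fin 7) ℝ) + vecMulVec x y + vecMulVec z w).det
      = a ^ 5 * ((a + x ⬝ᵥ y) * (a + z ⬝ᵥ w) - (x ⬝ᵥ w) * (z ⬝ᵥ y)) := by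
  have h : a • (1 : Matrix (Fin 7) (Fin 7) ℝ) + vecMulVec x y + vecMulVec z w
      = a • (1 + (Matrix.of fun (i : Fin 7) (k : Fin 2) => a⁻¹ * ![x i, z i] k) *
          (Matrix.of fun (k : Fin 2) (j : Fin 7) => ![y j, w j] k)) := by
    ext i j
    simp [Matrix.mul_apply, Fin.sum_univ_two, vecMulVec_apply]
    field_simp
    ring
  have hs : ∀ p q : Fin 7 → ℝ, ∑ j, p j * (a⁻¹ * q j) = a⁻¹ * (q ⬝ᵥ p) := by
    intro p q
    rw [dotProduct, Finset.mul_sum]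
    exact Finset.sum_congr rfl fun _ _ => by ring
  rw [h, det_smul, det_one_add_mul_comm, det_fin_two]
  simp [Matrix.mul_apply, hs]
  field_simp

lemma dot_crossMat (u p : Fin 7 → ℝ) : p ⬝ᵥ (crossMat u *ᵥ p) = 0 := by
  have h : p ⬝ᵥ (crossMat u *ᵥ p) = - (p ⬝ᵥ (crossMat u *ᵥ p)) := by
    conv_lhs => rw [dotProduct_mulVec, ← mulVec_transpose, crossMat_transpose, dotProduct_comm]
    simp [neg_mulVec]
  linarith

lemma dot_crossMat_left (u p : Fin 7 → ℝ) : u ⬝ᵥ (crossMat u *ᵥ p) = 0 := by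
  rw [dotProduct_mulVec, ← mulVec_transpose, crossMat_transpose, neg_mulVec, crossMat_mulVec_self]
  simp

/-- The determinant of a rank one perturbation of the skew matrix. -/
def pertDet (u p : Fin 7 → ℝ) : ℝ := (crossMat u + vecMulVec p p).det

lemma pertDet_mul (u p : Fin 7 → ℝ) (hu : u ⬝ᵥ u ≠ 0) :
    pertDet u p * pertDet u u = (u ⬝ᵥ u) ^ 6 * (u ⬝ᵥ p) ^ 2 := by
  have h1 : pertDet u u = (-crossMat u + vecMulVec u u).det := by
    rw [pertDet, ← det_transpose, transpose_add, crossMat_transpose, transpose_vecMulVec]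
  have h2 : (crossMat u + vecMulVec p p) * (-crossMat u + vecMulVec u u)
      = (u ⬝ᵥ u) • (1 : Matrix (Fin 7) (Fin 7) ℝ) + vecMulVec (-u) u
        + vecMulVec p (crossMat u *ᵥ p + (p ⬝ᵥ u) • u) := by
    have h3 : p ᵥ* crossMat u = - (crossMat u *ᵥ p) := by
      rw [← mulVec_transpose, crossMat_transpose, neg_mulVec]
    rw [add_mul, mul_add, mul_add, mul_neg, mul_neg, crossMat_sq, mul_vecMulVec,
      crossMat_mulVec_self, vecMulVec_mul, h3, vecMulVec_mul_vecMulVec]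
    ext i j
    simp [vecMulVec_apply]
    ring
  rw [h1, pertDet, ← det_mul, h2, det_rank_two _ hu]
  simp only [neg_dotProduct, dotProduct_add, dotProduct_smul, dot_crossMat, dot_crossMat_left,
    smul_eq_mul, dotProduct_comm p u]
  ring

lemma crossMat_transform (N : Matrix (Fin 7) (Fin 7) ℝ)
    (h : ∀ u v w : Fin 7 → ℝ, (N *ᵥ v) ⬝ᵥ (crossMat (N *ᵥ u) *ᵥ (N *ᵥ w))
      = v ⬝ᵥ (crossMat u *ᵥ w)) (u : Fin 7 → ℝ) :
    Nᵀ * crossMat (N *ᵥ u) * N = crossMat u := by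
  ext i j
  have := h u (Pi.single i 1) (Pi.single j 1)
  rw [dotProduct_comm, dotProduct_mulVec, ← mulVec_transpose, dotProduct_comm, mulVec_mulVec,
    mulVec_mulVec] at this
  simpa [← mul_assoc] using this

lemma pertDet_transform (N : Matrix (Fin 7) (Fin 7) ℝ)
    (h : ∀ u : Fin 7 → ℝ, Nᵀ * crossMat (N *ᵥ u) * N = crossMat u) (u p : Fin 7 → ℝ) :
    N.det ^ 2 * pertDet (N *ᵥ u) p = pertDet u (Nᵀ *ᵥ p) := by
  have : crossMat u + vecMulVec (Nᵀ *ᵥ p) (Nᵀ *ᵥ p)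
      = Nᵀ * (crossMat (N *ᵥ u) + vecMulVec p p) * N := by
    rw [mul_add, add_mul, h, mul_vecMulVec, vecMulVec_mul, mulVec_transpose]
  rw [pertDet, pertDet, this, det_mul, det_mul, det_transpose]
  ring

lemma crossMat_eq_zero (u : Fin 7 → ℝ) (h : crossMat u = 0) : u = 0 := by
  have h1 := crossMat_sq u
  have h2 := congrFun (congrFun h 0)
  have h3 := congrFun (congrFun h 1)
  ext i
  fin_cases i
  · simpa [crossMat] using h3 2
  · simpa [crossMat] using h2 2
  · simpa [crossMat] using h2 1
  · simpa [crossMat] using h2 4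
  · simpa [crossMat] using h2 3
  · simpa [crossMat] using h2 6
  · simpa [crossMat] using h2 5

lemma norm_scale (N : Matrix (Fin 7) (Fin 7) ℝ)
    (h : ∀ u : Fin 7 → ℝ, Nᵀ * crossMat (N *ᵥ u) * N = crossMat u) (u : Fin 7 → ℝ) :
    |N.det| * ((N *ᵥ u) ⬝ᵥ (N *ᵥ u)) = u ⬝ᵥ u := by
  by_cases hu : u = 0
  · simp [hu]
  have hNu : N *ᵥ u ≠ 0 := by
    intro h0
    have h1 := h u
    rw [h0] at h1
    have h2 : crossMat 0 = 0 := by ext i j; fin_cases i <;> fin_cases j <;> simp [crossMat]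
    rw [h2] at h1
    exact hu (crossMat_eq_zero u (by simpa using h1.symm))
  have ha : u ⬝ᵥ u ≠ 0 := by simpa [dotProduct_self_eq_zero] using hu
  have hb : (N *ᵥ u) ⬝ᵥ (N *ᵥ u) ≠ 0 := by simpa [dotProduct_self_eq_zero] using hNu
  have ha0 : 0 ≤ u ⬝ᵥ u := by simp only [dotProduct]; exact Finset.sum_nonneg fun i _ => mul_self_nonneg _
  have hb0 : 0 ≤ (N *ᵥ u) ⬝ᵥ (N *ᵥ u) := by
    simp only [dotProduct]; exact Finset.sum_nonneg fun i _ => mul_self_nonneg _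
  have e1 := pertDet_mul u u ha
  have e2 := pertDet_mul (N *ᵥ u) (N *ᵥ u) hb
  have e3 := pertDet_mul u (Nᵀ *ᵥ (N *ᵥ u)) ha
  rw [← pertDet_transform N h, dotProduct_mulVec u, vecMul_transpose] at e3
  generalize pertDet u u = D at *
  generalize pertDet (N *ᵥ u) (N *ᵥ u) = D' at *
  generalize (N *ᵥ u) ⬝ᵥ (N *ᵥ u) = b at *
  generalize u ⬝ᵥ u = a at *
  have key : (|N.det| * b) ^ 4 = a ^ 4 := by
    have e4 : (N.det ^ 2 * D' * D) ^ 2 = (a ^ 6 * b ^ 2) ^ 2 := by rw [e3]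
    have e5 : (a ^ 8 * b ^ 4) * (N.det ^ 4 * b ^ 4) = (a ^ 8 * b ^ 4) * a ^ 4 := by
      linear_combination e4 - N.det ^ 4 * (D * D) * e2 - N.det ^ 4 * b ^ 8 * e1
    have e6 := mul_left_cancel₀ (by positivity) e5
    rw [mul_pow, ← e6]
    congr 1
    exact Even.pow_abs (by decide) _
  exact (pow_left_inj₀ (by positivity) ha0 (by norm_num)).1 key

lemma norm_eq (N : Matrix (Fin 7) (Fin 7) ℝ)
    (h : ∀ u : Fin 7 → ℝ, Nᵀ * crossMat (N *ᵥ u) * N = crossMat u) (u : Fin 7 → ℝ) :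
    (N *ᵥ u) ⬝ᵥ (N *ᵥ u) = u ⬝ᵥ u := by
  have hs := norm_scale N h
  have hp : |N.det| • (Nᵀ * N) = 1 := by
    have hpol : ∀ u v : Fin 7 → ℝ, |N.det| * ((N *ᵥ u) ⬝ᵥ (N *ᵥ v)) = u ⬝ᵥ v := by
      intro u v
      have h1 := hs (u + v)
      have h2 := hs u
      have h3 := hs v
      simp only [mulVec_add, dotProduct_add, add_dotProduct] at h1
      rw [dotProduct_comm v u, dotProduct_comm (N *ᵥ v) (N *ᵥ u)] at h1
      linarith
    ext i j
    have := hpol (Pi.single i 1) (Pi.single j 1)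
    rw [dotProduct_comm, dotProduct_mulVec, ← mulVec_transpose, dotProduct_comm,
      mulVec_mulVec] at this
    simpa [Matrix.one_apply, Pi.single_apply, eq_comm (a := j)] using this
  have hd := congrArg Matrix.det hp
  rw [det_smul, det_mul, det_transpose, det_one] at hd
  have h9 : |N.det| ^ 9 = 1 := by
    rw [← abs_mul_abs_self] at hd
    simp only [Fintype.card_fin] at hd
    linear_combination hd
  have h1 : |N.det| = 1 := (pow_eq_one_iff_of_nonneg (abs_nonneg _) (by norm_num)).1 h9
  have := hs u
  rwa [h1, one_mul] at this

lemma g2_norm (A : E7 →L[ℝ] E7)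
    (hA : ∀ u v w : E7, phi0 (A u) (A v) (A w) = phi0 u v w) (u : E7) : ‖A u‖ = ‖u‖ := by
  set N : Matrix (Fin 7) (Fin 7) ℝ := LinearMap.toMatrix' 
    ((WithLp.linearEquiv 2 ℝ (Fin 7 → ℝ)).toLinearMap ∘ₗ A.toLinearMap ∘ₗ
      (WithLp.linearEquiv 2 ℝ (Fin 7 → ℝ)).symm.toLinearMap) with hN
  have hNA : ∀ x : E7, N *ᵥ x.ofLp = (A x).ofLp := by
    intro x
    rw [hN, LinearMap.toMatrix'_mulVec]
    simp
  have h := norm_eq N (crossMat_transform N (by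
    intro u v w
    have := hA (WithLp.toLp 2 u) (WithLp.toLp 2 v) (WithLp.toLp 2 w)
    rw [phi0_eq, phi0_eq, ← hNA, ← hNA, ← hNA] at this
    exact this)) u.ofLp
  rw [hNA] at h
  have hn : ∀ x : E7, ‖x‖ ^ 2 = x.ofLp ⬝ᵥ x.ofLp := by
    intro x
    rw [EuclideanSpace.real_norm_sq_eq]
    simp [dotProduct, sq]
  rw [← hn, ← hn] at h
  exact (pow_left_inj₀ (norm_nonneg _) (norm_nonneg _) (by norm_num)).1 h

lemma phi0_continuous : Continuous fun p : E7 × E7 × E7 => phi0 p.1 p.2.1 p.2.2 := by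
  simp only [phi0, tri7, Matrix.det_fin_three]
  simp
  fun_prop

/-- G₂, the group of invertible linear maps of ℝ⁷ preserving φ₀, is a compact subset of the
space of continuous linear endomorphisms of ℝ⁷. -/
theorem g2_isCompact :
    IsCompact {A : E7 →L[ℝ] E7 | Function.Bijective A ∧
      ∀ u v w : E7, phi0 (A u) (A v) (A w) = phi0 u v w} := by
  have hset : {A : E7 →L[ℝ] E7 | Function.Bijective A ∧
      ∀ u v w : E7, phi0 (A u) (A v) (A w) = phi0 u v w} =
      {A : E7 →L[ℝ] E7 | ∀ u v w : E7, phi0 (A u) (A v) (A w) = phi0 u v w} := by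
    ext A
    refine ⟨fun h => h.2, fun h => ⟨?_, h⟩⟩
    have hinj : Function.Injective A.toLinearMap := by
      rw [injective_iff_map_eq_zero]
      intro x hx
      have := g2_norm A h x
      rw [show A x = 0 from hx, norm_zero] at this
      exact norm_eq_zero.1 this.symm
    exact ⟨hinj, LinearMap.injective_iff_surjective.1 hinj⟩
  rw [hset]
  have : ProperSpace (E7 →L[ℝ] E7) := FiniteDimensional.proper ℝ _
  apply Metric.isCompact_of_isClosed_isBounded
  · simp only [Set.ofPred_forall]
    refine isClosed_iInter fun u => isClosed_iInter fun v => isClosed_iInter fun w => ?_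
    refine isClosed_eq ?_ continuous_const
    exact phi0_continuous.comp (f := fun A : E7 →L[ℝ] E7 => (A u, A v, A w)) (by fun_prop)
  · refine (Metric.isBounded_closedBall (x := (0 : E7 →L[ℝ] E7)) (r := 1)).subset ?_
    intro A hA
    rw [mem_closedBall_zero_iff]
    refine ContinuousLinearMap.opNorm_le_bound _ zero_le_one fun x => ?_
    rw [g2_norm A hA x, one_mul]
end
end

section
/- Let B : ℝ⁸ → ℝ⁸ be an invertible linear map satisfying B*Ω₀ = Ω₀. Then B is an orthogonal transformation of the standard inner product (⟨Bu, Bv⟩ = ⟨u, v⟩ for all u, v ∈ ℝ⁸) and det B = 1. In other words, the subgroup Spin(7) of GL(8,ℝ) preserving Ω₀ also preserves the Euclidean metric g₀ and the orientation of ℝ⁸, so Spin(7) is a subgroup of SO(8). -/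
open scoped RealInnerProductSpace

noncomputable section

/-- ℝ⁸ with its standard Euclidean inner product. -/
abbrev E8 := EuclideanSpace ℝ (Fin 8)

/-- The coordinate 4-form dx_i ∧ dx_j ∧ dx_k ∧ dx_l on ℝ⁸ (indices 0,…,7 for x₁,…,x₈). -/
def quad8 (i j k l : Fin 8) (a b c d : E8) : ℝ :=
  Matrix.det !![a i, a j, a k, a l; b i, b j, b k, b l;
                c i, c j, c k, c l; d i, d j, d k, d l]

/-- The Spin(7) 4-form Ω₀ = dx₁₂₃₄ + dx₁₂₅₆ + dx₁₂₇₈ + dx₁₃₅₇ − dx₁₃₆₈ − dx₁₄₅₈ − dx₁₄₆₇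
    − dx₂₃₅₈ − dx₂₃₆₇ − dx₂₄₅₇ + dx₂₄₆₈ + dx₃₄₅₆ + dx₃₄₇₈ + dx₅₆₇₈. -/
def Omega0 (a b c d : E8) : ℝ :=
  quad8 0 1 2 3 a b c d + quad8 0 1 4 5 a b c d + quad8 0 1 6 7 a b c d
    + quad8 0 2 4 6 a b c d - quad8 0 2 5 7 a b c d - quad8 0 3 4 7 a b c d
    - quad8 0 3 5 6 a b c d - quad8 1 2 4 7 a b c d - quad8 1 2 5 6 a b c d
    - quad8 1 3 4 6 a b c d + quad8 1 3 5 7 a b c d + quad8 2 3 4 5 a b c d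
    + quad8 2 3 6 7 a b c d + quad8 4 5 6 7 a b c d

lemma quad8_expand (i j k l : Fin 8) (a b c d : E8) : quad8 i j k l a b c d =
    (a i * b j - a j * b i) * (c k * d l - c l * d k)
    - (a i * b k - a k * b i) * (c j * d l - c l * d j)
    + (a i * b l - a l * b i) * (c j * d k - c k * d j)
    + (a j * b k - a k * b j) * (c i * d l - c l * d i)
    - (a j * b l - a l * b j) * (c i * d k - c k * d i)
    + (a k * b l - a l * b k) * (c i * d j - c j * d i) := by
  unfold quad8
  simp [Matrix.det_succ_row_zero, Fin.sum_univ_succ, Fin.succAbove]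
  ring

lemma Omega0_swap_last (a b c d : E8) : Omega0 a b d c = - Omega0 a b c d := by
  simp only [Omega0, quad8_expand]; ring

lemma Omega0_swap_mid (a b c d : E8) : Omega0 a c b d = - Omega0 a b c d := by
  have h (i j k l : Fin 8) : quad8 i j k l a c b d = - quad8 i j k l a b c d := by
    simp only [quad8_expand]; ring
  simp only [Omega0, h]; ring

lemma Omega0_swap_first (a b c d : E8) : Omega0 b a c d = - Omega0 a b c d := by
  simp only [Omega0, quad8_expand]; ring

lemma Omega0_add (a b c d d' : E8) : Omega0 a b c (d + d') = Omega0 a b c d + Omega0 a b c d' := by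
  have h (i j k l : Fin 8) : quad8 i j k l a b c (d + d') =
      quad8 i j k l a b c d + quad8 i j k l a b c d' := by
    simp only [quad8_expand, PiLp.add_apply]; ring
  simp only [Omega0, h]; ring

lemma Omega0_smul (a b c d : E8) (t : ℝ) : Omega0 a b c (t • d) = t * Omega0 a b c d := by
  have h (i j k l : Fin 8) : quad8 i j k l a b c (t • d) = t * quad8 i j k l a b c d := by
    simp only [quad8_expand, PiLp.smul_apply, smul_eq_mul]; ring
  simp only [Omega0, h]; ring

lemma Omega0_smul_all (a b c d : E8) (p q r t : ℝ) :
    Omega0 (p • a) (q • b) (r • c) (t • d) = p * q * r * t * Omega0 a b c d := by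
  have h (i j k l : Fin 8) : quad8 i j k l (p • a) (q • b) (r • c) (t • d)
      = p * q * r * t * quad8 i j k l a b c d := by
    simp only [quad8_expand, PiLp.smul_apply, smul_eq_mul]; ring
  simp only [Omega0, h]; ring

/-- The functional in the last slot. -/
def OmegaL (a b c : E8) : E8 →ₗ[ℝ] ℝ where
  toFun := Omega0 a b c
  map_add' := Omega0_add a b c
  map_smul' t d := Omega0_smul a b c d t

lemma sum_sq_onb (φ : E8 →ₗ[ℝ] ℝ) (w w' : OrthonormalBasis (Fin 8) ℝ E8) :
    ∑ i, φ (w i) ^ 2 = ∑ i, φ (w' i) ^ 2 := by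
  have key (w : OrthonormalBasis (Fin 8) ℝ E8) : ∑ i, φ (w i) ^ 2 =
      ‖(InnerProductSpace.toDual ℝ E8).symm (LinearMap.toContinuousLinearMap φ)‖ ^ 2 := by
    rw [← w.sum_sq_norm_inner_left]
    refine Finset.sum_congr rfl fun i _ => ?_
    rw [InnerProductSpace.toDual_symm_apply]
    simp
  rw [key, key]

lemma sum_sq_Omega0_onb (x y : E8) (w w' : OrthonormalBasis (Fin 8) ℝ E8) :
    ∑ k, ∑ l, Omega0 x y (w k) (w l) ^ 2 = ∑ k, ∑ l, Omega0 x y (w' k) (w' l) ^ 2 := by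
  calc _ = ∑ k, ∑ l, Omega0 x y (w k) (w' l) ^ 2 :=
        Finset.sum_congr rfl fun k _ => sum_sq_onb (OmegaL x y (w k)) w w'
    _ = ∑ l, ∑ k, Omega0 x y (w' l) (w k) ^ 2 := by
        rw [Finset.sum_comm]
        refine Finset.sum_congr rfl fun k _ => Finset.sum_congr rfl fun l _ => ?_
        rw [Omega0_swap_last, neg_sq]
    _ = _ := Finset.sum_congr rfl fun k _ => sum_sq_onb (OmegaL x y (w' k)) w w'

lemma sum_sq_Omega0_std (x y : E8) :
    ∑ k, ∑ l, Omega0 x y (EuclideanSpace.basisFun (Fin 8) ℝ k)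
      (EuclideanSpace.basisFun (Fin 8) ℝ l) ^ 2
      = 6 * ((∑ i, x i ^ 2) * (∑ i, y i ^ 2) - (∑ i, x i * y i) ^ 2) := by
  simp only [Omega0, quad8_expand, Fin.sum_univ_eight, EuclideanSpace.basisFun_apply,
    EuclideanSpace.single_apply]
  simp (decide := true) only [if_true, if_false, mul_zero, mul_one, zero_mul, sub_zero, zero_sub,
    add_zero, zero_add, sub_self, neg_zero]
  ring

lemma sum_sq_Omega0 (w : OrthonormalBasis (Fin 8) ℝ E8) (i j : Fin 8) :
    ∑ k, ∑ l, Omega0 (w i) (w j) (w k) (w l) ^ 2 = if i = j then 0 else 6 := by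
  rw [sum_sq_Omega0_onb _ _ w (EuclideanSpace.basisFun (Fin 8) ℝ), sum_sq_Omega0_std]
  have h (a b : E8) : ∑ i, a i * b i = ⟪a, b⟫ := by
    rw [PiLp.inner_apply]
    exact Finset.sum_congr rfl fun i _ => by simp [mul_comm]
  have h2 (a : E8) : ∑ i, a i ^ 2 = ⟪a, a⟫ := by
    rw [← h]
    exact Finset.sum_congr rfl fun i _ => pow_two _
  rw [h, h2, h2]
  simp only [w.inner_eq_ite]
  split_ifs <;> simp

lemma weighted_sum (w : OrthonormalBasis (Fin 8) ℝ E8) (s : Fin 8 → ℝ) (i : Fin 8) :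
    ∑ j, ∑ k, ∑ l, Omega0 (w i) (w j) (w k) (w l) ^ 2 * (s i + s j + s k + s l)
      = 24 * s i + 18 * ∑ j, s j := by
  have hD := sum_sq_Omega0 w i
  have e1 : ∑ j, ∑ k, ∑ l, Omega0 (w i) (w j) (w k) (w l) ^ 2 * s i = 42 * s i := by
    simp only [← Finset.sum_mul, hD]
    congr 1
    fin_cases i <;> simp [Fin.sum_univ_eight] <;> norm_num
  have e2 : ∑ j, ∑ k, ∑ l, Omega0 (w i) (w j) (w k) (w l) ^ 2 * s j = 6 * ∑ j, s j - 6 * s i := by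
    simp only [← Finset.sum_mul, hD]
    fin_cases i <;> simp [Fin.sum_univ_eight] <;> ring
  have e3 : ∑ j, ∑ k, ∑ l, Omega0 (w i) (w j) (w k) (w l) ^ 2 * s k = 6 * ∑ j, s j - 6 * s i := by
    rw [← e2, Finset.sum_comm]
    refine Finset.sum_congr rfl fun k _ => Finset.sum_congr rfl fun j _ =>
      Finset.sum_congr rfl fun l _ => ?_
    rw [Omega0_swap_mid, neg_sq]
  have e4 : ∑ j, ∑ k, ∑ l, Omega0 (w i) (w j) (w k) (w l) ^ 2 * s l = 6 * ∑ j, s j - 6 * s i := by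
    rw [← e3]
    refine Finset.sum_congr rfl fun j _ => ?_
    rw [Finset.sum_comm]
    refine Finset.sum_congr rfl fun k _ => Finset.sum_congr rfl fun l _ => ?_
    rw [Omega0_swap_last, neg_sq]
  simp only [mul_add, Finset.sum_add_distrib]
  rw [e1, e2, e3, e4]; ring

lemma sub_one_mul_log_nonneg {x : ℝ} (hx : 0 < x) : 0 ≤ (x - 1) * Real.log x := by
  rcases le_total 1 x with h | h
  · exact mul_nonneg (by linarith) (Real.log_nonneg h)
  · exact mul_nonneg_of_nonpos_of_nonpos (by linarith) (Real.log_nonpos hx.le h)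

lemma mu_eq_one (u w : OrthonormalBasis (Fin 8) ℝ E8) (μ : Fin 8 → ℝ) (hμ : ∀ i, 0 < μ i)
    (h : ∀ i j k l, Omega0 (u i) (u j) (u k) (u l) ^ 2
      = (μ i * μ j * μ k * μ l) * Omega0 (w i) (w j) (w k) (w l) ^ 2) (i : Fin 8) : μ i = 1 := by
  set s : Fin 8 → ℝ := fun i => Real.log (μ i) with hs
  have hlog (i j k l) : Real.log (μ i * μ j * μ k * μ l) = s i + s j + s k + s l := by
    have := fun i => (hμ i).ne'
    rw [Real.log_mul, Real.log_mul, Real.log_mul] <;> simp [this]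
  have hpos (i j k l) : 0 < μ i * μ j * μ k * μ l := by
    have := hμ i; have := hμ j; have := hμ k; have := hμ l; positivity
  have hnn (i j k l) : 0 ≤ Omega0 (w i) (w j) (w k) (w l) ^ 2 *
      ((μ i * μ j * μ k * μ l - 1) * (s i + s j + s k + s l)) := by
    rw [← hlog]
    exact mul_nonneg (sq_nonneg _) (sub_one_mul_log_nonneg (hpos i j k l))
  have hz (i : Fin 8) : ∑ j, ∑ k, ∑ l, Omega0 (w i) (w j) (w k) (w l) ^ 2 *
      ((μ i * μ j * μ k * μ l - 1) * (s i + s j + s k + s l)) = 0 := by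
    rw [← sub_self (24 * s i + 18 * ∑ j, s j)]
    nth_rw 1 [← weighted_sum u s i]
    rw [← weighted_sum w s i]
    simp only [← Finset.sum_sub_distrib]
    refine Finset.sum_congr rfl fun j _ => Finset.sum_congr rfl fun k _ =>
      Finset.sum_congr rfl fun l _ => ?_
    rw [h]; ring
  have hterm (i j k l) : Omega0 (w i) (w j) (w k) (w l) ^ 2 * (s i + s j + s k + s l) = 0 := by
    have h1 := (Finset.sum_eq_zero_iff_of_nonneg (fun j _ => Finset.sum_nonneg fun k _ =>
      Finset.sum_nonneg fun l _ => hnn i j k l)).1 (hz i) j (Finset.mem_univ _)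
    have h2 := (Finset.sum_eq_zero_iff_of_nonneg (fun k _ =>
      Finset.sum_nonneg fun l _ => hnn i j k l)).1 h1 k (Finset.mem_univ _)
    have h3 := (Finset.sum_eq_zero_iff_of_nonneg (fun l _ => hnn i j k l)).1 h2 l
      (Finset.mem_univ _)
    rcases mul_eq_zero.1 h3 with h4 | h4
    · rw [h4, zero_mul]
    rcases mul_eq_zero.1 h4 with h5 | h5
    · rw [← hlog, sub_eq_zero.1 h5, Real.log_one, mul_zero]
    · rw [h5, mul_zero]
  have hlin (i : Fin 8) : 24 * s i + 18 * ∑ j, s j = 0 := by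
    rw [← weighted_sum w s i]; simp [hterm]
  have hsum : ∑ j, s j = 0 := by
    have := Finset.sum_congr (rfl : (Finset.univ : Finset (Fin 8)) = _) fun i _ => hlin i
    rw [Finset.sum_add_distrib, ← Finset.mul_sum] at this
    simp at this
    linarith
  have hsi : Real.log (μ i) = 0 := by have := hlin i; rw [hsum] at this; simp only [hs] at this; linarith
  exact Real.eq_one_of_pos_of_log_eq_zero (hμ i) hsi

lemma metric_part (B : E8 →ₗ[ℝ] E8) (hB : Function.Bijective B)
    (hOmega : ∀ v₁ v₂ v₃ v₄ : E8,
      Omega0 (B v₁) (B v₂) (B v₃) (B v₄) = Omega0 v₁ v₂ v₃ v₄) (x y : E8) :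
    ⟪B x, B y⟫ = ⟪x, y⟫ := by
  have hsym : (LinearMap.adjoint B ∘ₗ B).IsSymmetric := LinearMap.isSymmetric_adjoint_mul_self B
  have hn : Module.finrank ℝ E8 = 8 := by simp
  set u := hsym.eigenvectorBasis hn with hu
  set μ := hsym.eigenvalues hn with hmu
  have hap (i) : LinearMap.adjoint B (B (u i)) = μ i • u i := by
    exact hsym.apply_eigenvectorBasis hn i
  have hin (i j) : ⟪B (u i), B (u j)⟫ = if i = j then μ i else 0 := by
    rw [← LinearMap.adjoint_inner_left, hap, real_inner_smul_left, u.inner_eq_ite]; simp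
  have hμ (i) : 0 < μ i := by
    have h1 := hin i i
    rw [if_pos rfl, real_inner_self_eq_norm_sq] at h1
    rw [← h1]
    have : B (u i) ≠ 0 := fun h => u.orthonormal.ne_zero i (hB.1 (by rw [h, map_zero]))
    positivity
  set σ : Fin 8 → ℝ := fun i => Real.sqrt (μ i) with hσ
  have hσ0 (i) : 0 < σ i := Real.sqrt_pos.2 (hμ i)
  have hσ2 (i) : σ i ^ 2 = μ i := Real.sq_sqrt (hμ i).le
  have hon : Orthonormal ℝ (fun i => (σ i)⁻¹ • B (u i)) := by
    rw [orthonormal_iff_ite]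
    intro i j
    rw [real_inner_smul_left, real_inner_smul_right, hin]
    split_ifs with h
    · subst h
      rw [← hσ2]; have := (hσ0 i).ne'; field_simp
    · simp
  let b := basisOfOrthonormalOfCardEqFinrank hon (by simp)
  have hb : ⇑b = fun i => (σ i)⁻¹ • B (u i) := coe_basisOfOrthonormalOfCardEqFinrank hon _
  let w : OrthonormalBasis (Fin 8) ℝ E8 := b.toOrthonormalBasis (by rw [hb]; exact hon)
  have hw (i) : B (u i) = σ i • w i := by
    have : w i = (σ i)⁻¹ • B (u i) := by
      simp only [w, Module.Basis.coe_toOrthonormalBasis, hb]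
    rw [this, smul_smul, mul_inv_cancel₀ (hσ0 i).ne', one_smul]
  have hone := mu_eq_one u w μ hμ (by
    intro i j k l
    rw [← hOmega, hw, hw, hw, hw, Omega0_smul_all, ← hσ2, ← hσ2, ← hσ2, ← hσ2]; ring)
  have hid : LinearMap.adjoint B ∘ₗ B = LinearMap.id := by
    refine u.toBasis.ext fun i => ?_
    simp [hap, hone]
  rw [← LinearMap.adjoint_inner_left]
  exact congrArg (fun z => ⟪z, y⟫) (LinearMap.congr_fun hid x)

/-- Complementary minors of an orthogonal block matrix. -/
lemma block_minor (M : Matrix (Fin 4 ⊕ Fin 4) (Fin 4 ⊕ Fin 4) ℝ) (hM : M * M.transpose = 1) :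
    M.det * M.toBlocks₁₁.det = M.toBlocks₂₂.det := by
  have h : M * Matrix.fromBlocks M.toBlocks₁₁.transpose 0 M.toBlocks₁₂.transpose 1
      = Matrix.fromBlocks 1 M.toBlocks₁₂ 0 M.toBlocks₂₂ := by
    have h1 := hM
    rw [← Matrix.fromBlocks_toBlocks M, Matrix.fromBlocks_transpose, Matrix.fromBlocks_multiply,
      ← Matrix.fromBlocks_one, Matrix.fromBlocks_inj] at h1
    conv_lhs => rw [← Matrix.fromBlocks_toBlocks M]
    rw [Matrix.fromBlocks_multiply, Matrix.fromBlocks_inj]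
    simp only [mul_zero, mul_one, Matrix.mul_zero, Matrix.mul_one, zero_add]
    exact ⟨h1.1, trivial, h1.2.2.1, trivial⟩
  have h2 := congrArg Matrix.det h
  rw [Matrix.det_mul, Matrix.det_fromBlocks_zero₁₂, Matrix.det_fromBlocks_zero₂₁] at h2
  simpa using h2

lemma perm_minor (M : Matrix (Fin 8) (Fin 8) ℝ) (hM : M * M.transpose = 1)
    (p : Equiv.Perm (Fin 8)) (hp : Equiv.Perm.sign p = 1) (v : Fin 8 → E8)
    (hv : ∀ i j, v j i = M i j) :
    M.det * quad8 (p 0) (p 1) (p 2) (p 3) (v 0) (v 1) (v 2) (v 3)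
      = quad8 (p 4) (p 5) (p 6) (p 7) (v 4) (v 5) (v 6) (v 7) := by
  let e : Fin 4 ⊕ Fin 4 ≃ Fin 8 := finSumFinEquiv
  have hN := block_minor (M.submatrix (e.trans p) e) (by
    rw [Matrix.transpose_submatrix, Matrix.submatrix_mul_equiv, hM]
    exact Matrix.submatrix_one_equiv _)
  have hd : (M.submatrix (e.trans p) e).det = M.det := by
    have : M.submatrix (e.trans p) e = (M.submatrix p id).submatrix e e := by
      ext; simp
    rw [this, Matrix.det_submatrix_equiv_self, Matrix.det_permute, hp]; simp
  have q1 : quad8 (p 0) (p 1) (p 2) (p 3) (v 0) (v 1) (v 2) (v 3)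
      = (M.submatrix (e.trans p) e).toBlocks₁₁.det := by
    rw [← Matrix.det_transpose (Matrix.toBlocks₁₁ _)]
    unfold quad8
    congr 1
    ext i j
    fin_cases i <;> fin_cases j <;> exact hv _ _
  have q2 : quad8 (p 4) (p 5) (p 6) (p 7) (v 4) (v 5) (v 6) (v 7)
      = (M.submatrix (e.trans p) e).toBlocks₂₂.det := by
    rw [← Matrix.det_transpose (Matrix.toBlocks₂₂ _)]
    unfold quad8
    congr 1
    ext i j
    fin_cases i <;> fin_cases j <;> exact hv _ _
  rw [q1, q2, ← hN, hd]

lemma list_minor (M : Matrix (Fin 8) (Fin 8) ℝ) (hM : M * M.transpose = 1)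
    (v : Fin 8 → E8) (hv : ∀ i j, v j i = M i j) (f : Fin 8 → Fin 8) (hf : Function.Bijective f)
    (hs : Equiv.Perm.sign (Equiv.ofBijective f hf) = 1) :
    M.det * quad8 (f 0) (f 1) (f 2) (f 3) (v 0) (v 1) (v 2) (v 3)
      = quad8 (f 4) (f 5) (f 6) (f 7) (v 4) (v 5) (v 6) (v 7) :=
  perm_minor M hM (Equiv.ofBijective f hf) hs v hv

lemma self_dual (M : Matrix (Fin 8) (Fin 8) ℝ) (hM : M * M.transpose = 1)
    (v : Fin 8 → E8) (hv : ∀ i j, v j i = M i j) :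
    M.det * Omega0 (v 0) (v 1) (v 2) (v 3) = Omega0 (v 4) (v 5) (v 6) (v 7) := by
  have H := list_minor M hM v hv
  have h1 := H ![0, 1, 2, 3, 4, 5, 6, 7] (by decide) (by decide)
  have h2 := H ![0, 1, 4, 5, 2, 3, 6, 7] (by decide) (by decide)
  have h3 := H ![0, 1, 6, 7, 2, 3, 4, 5] (by decide) (by decide)
  have h4 := H ![0, 2, 4, 6, 1, 3, 5, 7] (by decide) (by decide)
  have h5 := H ![0, 2, 5, 7, 1, 3, 4, 6] (by decide) (by decide)
  have h6 := H ![0, 3, 4, 7, 1, 2, 5, 6] (by decide) (by decide)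
  have h7 := H ![0, 3, 5, 6, 1, 2, 4, 7] (by decide) (by decide)
  have h8 := H ![1, 2, 4, 7, 0, 3, 5, 6] (by decide) (by decide)
  have h9 := H ![1, 2, 5, 6, 0, 3, 4, 7] (by decide) (by decide)
  have h10 := H ![1, 3, 4, 6, 0, 2, 5, 7] (by decide) (by decide)
  have h11 := H ![1, 3, 5, 7, 0, 2, 4, 6] (by decide) (by decide)
  have h12 := H ![2, 3, 4, 5, 0, 1, 6, 7] (by decide) (by decide)
  have h13 := H ![2, 3, 6, 7, 0, 1, 4, 5] (by decide) (by decide)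
  have h14 := H ![4, 5, 6, 7, 0, 1, 2, 3] (by decide) (by decide)
  simp only [Matrix.cons_val] at h1 h2 h3 h4 h5 h6 h7 h8 h9 h10 h11 h12 h13 h14
  unfold Omega0
  linear_combination h1 + h2 + h3 + h4 - h5 - h6 - h7 - h8 - h9 - h10 + h11 + h12 + h13 + h14

lemma det_part (B : E8 →ₗ[ℝ] E8)
    (hOmega : ∀ v₁ v₂ v₃ v₄ : E8,
      Omega0 (B v₁) (B v₂) (B v₃) (B v₄) = Omega0 v₁ v₂ v₃ v₄)
    (hin : ∀ x y : E8, ⟪B x, B y⟫ = ⟪x, y⟫) : LinearMap.det B = 1 := by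
  set e := EuclideanSpace.basisFun (Fin 8) ℝ with he
  set M := LinearMap.toMatrix e.toBasis e.toBasis B with hMdef
  have hv (i j) : B (e j) i = M i j := by
    simp [hMdef, he, LinearMap.toMatrix_apply]
  have hM' : M.transpose * M = 1 := by
    ext i j
    have h1 := hin (e i) (e j)
    rw [e.inner_eq_ite, PiLp.inner_apply] at h1
    rw [Matrix.mul_apply, Matrix.one_apply, ← h1]
    refine Finset.sum_congr rfl fun k _ => ?_
    simp [hv, mul_comm]
  have hM : M * M.transpose = 1 := mul_eq_one_comm.1 hM'
  have hsd := self_dual M hM (fun j => B (e j)) hv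
  simp only [hOmega] at hsd
  have a1 : Omega0 (e 0) (e 1) (e 2) (e 3) = 1 := by
    simp [Omega0, quad8_expand, he, EuclideanSpace.single_apply]
  have a2 : Omega0 (e 4) (e 5) (e 6) (e 7) = 1 := by
    simp [Omega0, quad8_expand, he, EuclideanSpace.single_apply]
  rw [a1, a2, mul_one] at hsd
  rw [← LinearMap.det_toMatrix e.toBasis]
  exact hsd

/-- If an invertible linear map B : ℝ⁸ → ℝ⁸ preserves the 4-form Ω₀ (B*Ω₀ = Ω₀), then B
preserves the standard inner product and has determinant 1; i.e. Spin(7) ⊆ SO(8). -/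
theorem spin7_preserves_metric_and_orientation (B : E8 →ₗ[ℝ] E8)
    (hB : Function.Bijective B)
    (hOmega : ∀ v₁ v₂ v₃ v₄ : E8,
      Omega0 (B v₁) (B v₂) (B v₃) (B v₄) = Omega0 v₁ v₂ v₃ v₄) :
    (∀ u v : E8, ⟪B u, B v⟫ = ⟪u, v⟫) ∧ LinearMap.det B = 1 := by
  exact ⟨metric_part B hB hOmega, det_part B hOmega (metric_part B hB hOmega)⟩
end
end
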